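/- Let Q be a symmetric real n×n matrix, i ≠ j indices, S a semi-symmetry set for (i,j), and Q_mod the modified (n+1)×(n+1) matrix, where z satisfies z ≥ Σ_{k∈S} |Q[i,k]|. Then for every binary vector x ∈ {0,1}^n and every ancilla value a ∈ {0,1}, H_{Q_mod}((x,a)) ≥ H_Q(x); that is, the modification never decreases the energy of any solution. -/

import Mathlib

open Finset

/-- Energy of a binary vector `x` w.r.t. a QUBO matrix `Q`:
`H_Q(x) = Σ_k Q[k,k]·x_k + Σ_{k<l} Q[k,l]·x_k·x_l`. -/
def energy {m : ℕ} (Q : Fin m → Fin m → ℝ) (x : Fin m → ℝ) : ℝ :=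
  ∑ k, Q k k * x k + ∑ k, ∑ l, if k < l then Q k l * x k * x l else 0

/-- `x` is a binary (0/1-valued) vector. -/
def IsBinary {m : ℕ} (x : Fin m → ℝ) : Prop := ∀ k, x k = 0 ∨ x k = 1

/-- Entries of the new (n+1)-st row/column of the modified matrix. -/
def modCol {n : ℕ} (Q : Fin n → Fin n → ℝ) (i j : Fin n) (S : Finset (Fin n)) (z : ℝ)
    (k : Fin n) : ℝ :=
  if k = i ∨ k = j then -2 * z else if k ∈ S then Q i k else 0

/-- Entries of the modified matrix among the original n indices. -/
def modCore {n : ℕ} (Q : Fin n → Fin n → ℝ) (i j : Fin n) (S : Finset (Fin n)) (z : ℝ)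
    (k l : Fin n) : ℝ :=
  if k = i ∧ l = i then Q i i + z
  else if k = j ∧ l = j then Q j j + z
  else if (k = i ∧ l = j) ∨ (k = j ∧ l = i) then Q i j + 2 * z
  else if (k = i ∨ k = j) ∧ l ∈ S then 0
  else if (l = i ∨ l = j) ∧ k ∈ S then 0
  else Q k l

/-- The modified (n+1)×(n+1) QUBO matrix `Q_mod` obtained from `Q` by factoring out the
semi-symmetry `S` of the conflicting pair `(i,j)` into the ancilla qubit (index `n+1`). -/
def modQ {n : ℕ} (Q : Fin n → Fin n → ℝ) (i j : Fin n) (S : Finset (Fin n)) (z : ℝ) :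
    Fin (n + 1) → Fin (n + 1) → ℝ := fun a b =>
  if ha : a = Fin.last n then
    if hb : b = Fin.last n then z
    else modCol Q i j S z (b.castPred hb)
  else if hb : b = Fin.last n then modCol Q i j S z (a.castPred ha)
  else modCore Q i j S z (a.castPred ha) (b.castPred hb)

theorem modQ_castSucc_castSucc {n : ℕ} (Q : Fin n → Fin n → ℝ) (i j : Fin n)
    (S : Finset (Fin n)) (z : ℝ) (k l : Fin n) :
    modQ Q i j S z k.castSucc l.castSucc = modCore Q i j S z k l := by
  simp [modQ, Fin.castSucc_ne_last]

theorem modQ_castSucc_last {n : ℕ} (Q : Fin n → Fin n → ℝ) (i j : Fin n)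
    (S : Finset (Fin n)) (z : ℝ) (k : Fin n) :
    modQ Q i j S z k.castSucc (Fin.last n) = modCol Q i j S z k := by
  simp [modQ, Fin.castSucc_ne_last]

theorem modQ_last_last {n : ℕ} (Q : Fin n → Fin n → ℝ) (i j : Fin n)
    (S : Finset (Fin n)) (z : ℝ) :
    modQ Q i j S z (Fin.last n) (Fin.last n) = z := by
  simp [modQ]

/-- Splitting the ancilla off the energy of the modified matrix. -/
theorem energy_modQ_snoc {n : ℕ} (Q : Fin n → Fin n → ℝ) (i j : Fin n)
    (S : Finset (Fin n)) (z : ℝ) (x : Fin n → ℝ) (a : ℝ) :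
    energy (modQ Q i j S z) (Fin.snoc x a) =
      energy (modCore Q i j S z) x + z * a + (∑ k, modCol Q i j S z k * x k) * a := by
  have h (l : Fin n) : ¬ Fin.last n < l.castSucc := (Fin.castSucc_lt_last l).le.not_gt
  simp only [energy, Fin.sum_univ_castSucc, Fin.snoc_castSucc, Fin.snoc_last,
    modQ_castSucc_castSucc, modQ_castSucc_last, modQ_last_last, Fin.castSucc_lt_castSucc_iff,
    Fin.castSucc_lt_last, h, lt_irrefl, if_true, if_false, sum_const_zero, sum_add_distrib,
    sum_mul]
  ring

/-- The energy as a full quadratic form, for symmetric matrices. -/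
theorem two_mul_energy {m : ℕ} {Q : Fin m → Fin m → ℝ} (hQ : ∀ k l, Q k l = Q l k)
    {x : Fin m → ℝ} (hx : IsBinary x) :
    2 * energy Q x = ∑ k, Q k k * x k + ∑ k, ∑ l, Q k l * x k * x l := by
  have hsplit : ∑ k, ∑ l, Q k l * x k * x l =
      (∑ k, ∑ l, if k < l then Q k l * x k * x l else 0) +
      (∑ k, ∑ l, if l < k then Q k l * x k * x l else 0) +
      ∑ k, ∑ l, if k = l then Q k l * x k * x l else 0 := by
    simp only [← sum_add_distrib]
    refine sum_congr rfl fun k _ => sum_congr rfl fun l _ => ?_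
    rcases lt_trichotomy k l with h | h | h
    · simp [h, h.not_gt, h.ne]
    · simp [h]
    · simp [h, h.not_gt, h.ne']
  have hswap : (∑ k, ∑ l, if l < k then Q k l * x k * x l else 0) =
      ∑ k, ∑ l, if k < l then Q k l * x k * x l else 0 := by
    rw [sum_comm]
    refine sum_congr rfl fun k _ => sum_congr rfl fun l _ => ?_
    rw [hQ l k, mul_right_comm]
  have hdiag : (∑ k, ∑ l, if k = l then Q k l * x k * x l else 0) = ∑ k, Q k k * x k := by
    refine sum_congr rfl fun k _ => ?_
    rcases hx k with h | h <;> simp [h]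
  rw [hsplit, hswap, hdiag, energy]
  ring

/-- The modification of the core entries as a sum of indicator terms. -/
theorem modCore_eq_add {n : ℕ} {Q : Fin n → Fin n → ℝ} {i j : Fin n} {S : Finset (Fin n)}
    (z : ℝ) (hQ : ∀ k l, Q k l = Q l k) (hij : i ≠ j) (hiS : i ∉ S) (hjS : j ∉ S)
    (hsemi : ∀ k ∈ S, Q i k = Q j k) (k l : Fin n) :
    modCore Q i j S z k l = Q k l +
      ((if k = i then if l = i then z else 0 else 0) +
        (if k = j then if l = j then z else 0 else 0) +
        (if k = i then if l = j then 2 * z else 0 else 0) +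
        (if k = j then if l = i then 2 * z else 0 else 0) -
        (if k = i then if l ∈ S then Q i l else 0 else 0) -
        (if k = j then if l ∈ S then Q i l else 0 else 0) -
        (if l = i then if k ∈ S then Q i k else 0 else 0) -
        (if l = j then if k ∈ S then Q i k else 0 else 0)) := by
  unfold modCore
  grind

theorem energy_modCore {n : ℕ} {Q : Fin n → Fin n → ℝ} {i j : Fin n} {S : Finset (Fin n)}
    (z : ℝ) (hQ : ∀ k l, Q k l = Q l k) (hij : i ≠ j) (hiS : i ∉ S) (hjS : j ∉ S)
    (hsemi : ∀ k ∈ S, Q i k = Q j k) {x : Fin n → ℝ} (hx : IsBinary x) :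
    energy (modCore Q i j S z) x = energy Q x + z * (x i + x j + 2 * (x i * x j)) -
      (x i + x j) * ∑ k ∈ S, Q i k * x k := by
  have hcore := modCore_eq_add z hQ hij hiS hjS hsemi
  have hsymm (k l : Fin n) : modCore Q i j S z k l = modCore Q i j S z l k := by
    rw [hcore, hcore, hQ k l]
    grind
  have hsq (k : Fin n) : x k * x k = x k := by
    rcases hx k with h | h <;> simp [h]
  have hlin : ∑ k, modCore Q i j S z k k * x k = ∑ k, Q k k * x k + z * x i + z * x j := by
    have h (k : Fin n) : modCore Q i j S z k k * x k =
        Q k k * x k + (if k = i then z * x k else 0) + (if k = j then z * x k else 0) := by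
      rw [hcore]
      grind
    simp [h, sum_add_distrib]
  have hquad : ∑ k, ∑ l, modCore Q i j S z k l * x k * x l =
      ∑ k, ∑ l, Q k l * x k * x l + z * (x i * x i) + z * (x j * x j) +
        4 * z * (x i * x j) - 2 * ((x i + x j) * ∑ k ∈ S, Q i k * x k) := by
    simp only [hcore, add_mul, sub_mul, ite_mul, zero_mul, sum_add_distrib, sum_sub_distrib,
      sum_ite_irrel, sum_const_zero, sum_ite_eq', sum_ite_mem, univ_inter, mem_univ, if_true]
    have h₁ (c : ℝ) : ∑ l ∈ S, Q i l * c * x l = c * ∑ k ∈ S, Q i k * x k := by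
      rw [mul_sum]
      exact sum_congr rfl fun _ _ => by ring
    have h₂ (c : ℝ) : ∑ l ∈ S, Q i l * x l * c = c * ∑ k ∈ S, Q i k * x k := by
      rw [mul_comm, sum_mul]
    simp only [h₁, h₂]
    ring
  have h := two_mul_energy hsymm hx
  rw [hlin, hquad, hsq, hsq] at h
  linarith [two_mul_energy hQ hx]

theorem sum_modCol_mul {n : ℕ} (Q : Fin n → Fin n → ℝ) {i j : Fin n} {S : Finset (Fin n)}
    (z : ℝ) (hij : i ≠ j) (hiS : i ∉ S) (hjS : j ∉ S) (x : Fin n → ℝ) :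
    ∑ k, modCol Q i j S z k * x k = -2 * z * (x i + x j) + ∑ k ∈ S, Q i k * x k := by
  have h (k : Fin n) : modCol Q i j S z k * x k =
      (if k = i then -2 * z * x k else 0) + (if k = j then -2 * z * x k else 0) +
        (if k ∈ S then Q i k * x k else 0) := by
    unfold modCol
    grind
  simp only [h, sum_add_distrib, sum_ite_eq', sum_ite_mem, univ_inter, mem_univ, if_true]
  ring

theorem abs_sum_mul_le_of_isBinary {n : ℕ} (c : Fin n → ℝ) (S : Finset (Fin n))
    {x : Fin n → ℝ} (hx : IsBinary x) : |∑ k ∈ S, c k * x k| ≤ ∑ k ∈ S, |c k| := by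
  refine (abs_sum_le_sum_abs _ _).trans (sum_le_sum fun k _ => ?_)
  rcases hx k with h | h <;> simp [h]

/-- with `z ≥ Σ_{k∈S} |Q[i,k]|`, for every binary `x` and every ancilla
value `a ∈ {0,1}`, the modified energy never decreases: `H_{Q_mod}((x,a)) ≥ H_Q(x)`. -/
theorem stmt9
    {n : ℕ} (Q : Fin n → Fin n → ℝ) (i j : Fin n) (S : Finset (Fin n)) (z : ℝ)
    (hQsymm : ∀ k l, Q k l = Q l k) (hij : i ≠ j)
    (hiS : i ∉ S) (hjS : j ∉ S) (hsemi : ∀ k ∈ S, Q i k = Q j k)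
    (x : Fin n → ℝ) (hx : IsBinary x)
    (hz : (∑ k ∈ S, |Q i k|) ≤ z)
    (a : ℝ) (ha : a = 0 ∨ a = 1) :
    energy (modQ Q i j S z) (Fin.snoc x a) ≥ energy Q x := by
  obtain ⟨hlo, hhi⟩ := abs_le.mp ((abs_sum_mul_le_of_isBinary (Q i) S hx).trans hz)
  rw [energy_modQ_snoc, energy_modCore z hQsymm hij hiS hjS hsemi hx,
    sum_modCol_mul Q z hij hiS hjS]
  rcases hx i with hi | hi <;> rcases hx j with hj | hj <;> rcases ha with rfl | rfl <;>
    rw [hi, hj] <;> linarith
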